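/- arXiv:2604.00380 — 3 statements merged into one kernel-verified Lean document; each statement's English description precedes it below -/
import Mathlib

section
/- Let n ≥ 1, let γ : Fin n → ℝ² be points all contained in a set of diameter at most D (i.e., ‖γ(i) − γ(j)‖ ≤ D for all i, j), and for a : Fin n → ℝ define the softmax-weighted mean m(a) = (Σ_i γ(i)·exp(a(i))) / (Σ_i exp(a(i))). Then for all a, a' : Fin n → ℝ, ‖m(a) − m(a')‖ ≤ D·max_i |a(i) − a'(i)|. -/
open Finset

section SoftmaxMean

variable {ι E : Type*} [Fintype ι] [Nonempty ι] [NormedAddCommGroup E] [NormedSpace ℝ E]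

theorem sum_exp_pos (a : ι → ℝ) : 0 < ∑ i, Real.exp (a i) :=
  Finset.sum_pos (fun i _ => Real.exp_pos (a i)) Finset.univ_nonempty

/-- Normalized exponential weights bound the norm of an average by a bound on its terms. -/
theorem norm_softmax_mean_le {v : ι → E} {C : ℝ} (hv : ∀ i, ‖v i‖ ≤ C) (a : ι → ℝ) :
    ‖(∑ i, Real.exp (a i))⁻¹ • ∑ i, Real.exp (a i) • v i‖ ≤ C := by
  have hS := sum_exp_pos a
  rw [norm_smul, norm_inv, Real.norm_of_nonneg hS.le, inv_mul_le_iff₀ hS, Finset.sum_mul]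
  refine norm_sum_le_of_le _ fun i _ => ?_
  rw [norm_smul, Real.norm_of_nonneg (Real.exp_pos _).le]
  exact mul_le_mul_of_nonneg_left (hv i) (Real.exp_pos _).le

theorem softmax_mean_sub_const (γ : ι → E) (a : ι → ℝ) (c : E) :
    (∑ i, Real.exp (a i))⁻¹ • ∑ i, Real.exp (a i) • (c - γ i)
      = c - (∑ i, Real.exp (a i))⁻¹ • ∑ i, Real.exp (a i) • γ i := by
  simp_rw [smul_sub, Finset.sum_sub_distrib, ← Finset.sum_smul]
  rw [smul_sub, inv_smul_smul₀ (sum_exp_pos a).ne']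

/-- Along a line of logits, the derivative of the softmax mean is the softmax mean of the
deviations from it, scaled by the direction. -/
theorem hasDerivAt_softmax_mean (γ : ι → E) (a b : ι → ℝ) (t : ℝ) :
    HasDerivAt
      (fun t : ℝ => (∑ i, Real.exp (a i + t * b i))⁻¹ • ∑ i, Real.exp (a i + t * b i) • γ i)
      ((∑ i, Real.exp (a i + t * b i))⁻¹ • ∑ i, Real.exp (a i + t * b i) •
        b i • (γ i - (∑ j, Real.exp (a j + t * b j))⁻¹ • ∑ j, Real.exp (a j + t * b j) • γ j))
      t := by
  have hw (i : ι) : HasDerivAt (fun t : ℝ => Real.exp (a i + t * b i))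
      (Real.exp (a i + t * b i) * b i) t := by
    simpa using (((hasDerivAt_id t).mul_const (b i)).const_add (a i)).exp
  have hS : HasDerivAt (fun t : ℝ => ∑ i, Real.exp (a i + t * b i))
      (∑ i, Real.exp (a i + t * b i) * b i) t := HasDerivAt.fun_sum fun i _ => hw i
  have hN : HasDerivAt (fun t : ℝ => ∑ i, Real.exp (a i + t * b i) • γ i)
      (∑ i, (Real.exp (a i + t * b i) * b i) • γ i) t :=
    HasDerivAt.fun_sum fun i _ => (hw i).smul_const (γ i)
  have hpos := sum_exp_pos fun i => a i + t * b i
  convert (hS.fun_inv hpos.ne').fun_smul hN using 1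
  simp_rw [smul_smul, smul_sub, Finset.sum_sub_distrib, ← Finset.sum_smul]
  rw [smul_sub, sub_eq_add_neg, smul_smul, smul_smul, ← neg_smul]
  congr 2
  field_simp

/-- The softmax mean of points at mutual distance at most `D` is `D`-Lipschitz in the logits. -/
theorem norm_softmax_mean_sub_le {γ : ι → E} {D M : ℝ} (hD : ∀ i j, ‖γ i - γ j‖ ≤ D)
    {a a' : ι → ℝ} (hM : ∀ i, |a i - a' i| ≤ M) :
    ‖(∑ i, Real.exp (a i))⁻¹ • (∑ i, Real.exp (a i) • γ i)
        - (∑ i, Real.exp (a' i))⁻¹ • (∑ i, Real.exp (a' i) • γ i)‖ ≤ D * M := by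
  have hM0 : 0 ≤ M := (abs_nonneg _).trans (hM (Classical.arbitrary ι))
  have key := norm_image_sub_le_of_norm_deriv_le_segment_01' (C := D * M)
    (fun t _ => (hasDerivAt_softmax_mean γ a' (fun i => a i - a' i) t).hasDerivWithinAt)
    (fun t _ => norm_softmax_mean_le (fun i => ?_) _)
  · simpa using key
  · rw [norm_smul, Real.norm_eq_abs, mul_comm D, ← softmax_mean_sub_const]
    exact mul_le_mul (hM i) (norm_softmax_mean_le (hD i) _) (norm_nonneg _) hM0

end SoftmaxMean

/-- The softmax-weighted mean of points of diameter at most D is Lipschitz in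
the logits with constant D w.r.t. the sup norm. -/
theorem softmax_mean_lipschitz
    (n : ℕ) (hn : 1 ≤ n) (D : ℝ)
    (γ : Fin n → EuclideanSpace ℝ (Fin 2))
    (hD : ∀ i j, ‖γ i - γ j‖ ≤ D)
    (a a' : Fin n → ℝ) :
    ‖(∑ i, Real.exp (a i))⁻¹ • (∑ i, Real.exp (a i) • γ i)
        - (∑ i, Real.exp (a' i))⁻¹ • (∑ i, Real.exp (a' i) • γ i)‖
      ≤ D * (Finset.univ.sup' (Finset.univ_nonempty_iff.mpr ⟨⟨0, hn⟩⟩)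
              fun i => |a i - a' i|) := by
  have : Nonempty (Fin n) := ⟨⟨0, hn⟩⟩
  exact norm_softmax_mean_sub_le hD fun i =>
    Finset.le_sup' (fun i => |a i - a' i|) (Finset.mem_univ i)
end

section
/- Let Γcand be a nonempty finite set of points in ℝ² contained in a set of diameter at most D, let J : Γcand → ℝ, τ > 0, κ > 0, and for p : Γcand → ℝ define weights w_p(γ) = exp(J(γ)/τ − κ·ln(1 + exp(p(γ)))) and the selector γ*(p) = (Σ_{γ ∈ Γcand} γ·w_p(γ)) / (Σ_{γ ∈ Γcand} w_p(γ)). Then for all p, p' : Γcand → ℝ, ‖γ*(p) − γ*(p')‖ ≤ κ·D·max_{γ ∈ Γcand} |p(γ) − p'(γ)|, i.e., the smooth parameter selector is Lipschitz in the predicted safety loss with constant κ·D with respect to the sup norm. -/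
open Finset

section ExpWeightedMean

variable {E : Type*} [NormedAddCommGroup E] [NormedSpace ℝ E]

/-- A point lies within `D` of any weighted mean of points that are within `D` of it. -/
theorem norm_sub_weighted_mean_le {ι : Type*} {s : Finset ι} {w : ι → ℝ} {x : ι → E} {y : E}
    {D : ℝ} (hw : ∀ i ∈ s, 0 ≤ w i) (hs : 0 < ∑ i ∈ s, w i) (hD : ∀ i ∈ s, ‖y - x i‖ ≤ D) :
    ‖y - (∑ i ∈ s, w i)⁻¹ • ∑ i ∈ s, w i • x i‖ ≤ D := by
  have h := (convex_closedBall y D).centerMass_mem hw hs (z := x) fun i hi => by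
    simpa [dist_eq_norm, norm_sub_rev] using hD i hi
  simpa [Finset.centerMass, dist_eq_norm, norm_sub_rev] using h

/-- The mean of a finite family of points with weights `exp (u i)` is Lipschitz in `u`. -/
theorem norm_exp_weighted_mean_sub_le {ι : Type*} {s : Finset ι} (hs : s.Nonempty) {x : ι → E}
    {D ε : ℝ} (hD : ∀ i ∈ s, ∀ j ∈ s, ‖x i - x j‖ ≤ D) {u v : ι → ℝ}
    (huv : ∀ i ∈ s, |u i - v i| ≤ ε) :
    ‖(∑ i ∈ s, Real.exp (u i))⁻¹ • ∑ i ∈ s, Real.exp (u i) • x i -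
      (∑ i ∈ s, Real.exp (v i))⁻¹ • ∑ i ∈ s, Real.exp (v i) • x i‖ ≤ ε * D := by
  let W : ℝ → ι → ℝ := fun t i => Real.exp (v i + t * (u i - v i))
  let m : ℝ → E := fun t => (∑ i ∈ s, W t i)⁻¹ • ∑ i ∈ s, W t i • x i
  have hWpos : ∀ t, 0 < ∑ i ∈ s, W t i := fun t => Finset.sum_pos (fun i _ => Real.exp_pos _) hs
  have hW : ∀ t i, HasDerivAt (fun t => W t i) (W t i * (u i - v i)) t := fun t i => by
    simpa [W] using (((hasDerivAt_id t).mul_const (u i - v i)).const_add (v i)).exp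
  have hm : ∀ t, HasDerivAt m
      ((∑ i ∈ s, W t i)⁻¹ • ∑ i ∈ s, (W t i * (u i - v i)) • (x i - m t)) t := fun t => by
    have hZ := HasDerivAt.fun_sum (u := s) fun i _ => hW t i
    have hN := HasDerivAt.fun_sum (u := s) fun i _ => (hW t i).smul_const (x i)
    convert (hZ.fun_inv (hWpos t).ne').fun_smul hN using 1
    simp only [smul_sub, Finset.sum_sub_distrib, ← Finset.sum_smul, m]
    module
  have hbound : ∀ t, ‖(∑ i ∈ s, W t i)⁻¹ • ∑ i ∈ s, (W t i * (u i - v i)) • (x i - m t)‖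
      ≤ ε * D := fun t => by
    rw [norm_smul, norm_inv, Real.norm_of_nonneg (hWpos t).le, inv_mul_le_iff₀ (hWpos t),
      Finset.sum_mul]
    refine norm_sum_le_of_le s fun i hi => ?_
    have hx : ‖x i - m t‖ ≤ D :=
      norm_sub_weighted_mean_le (fun j _ => (Real.exp_pos _).le) (hWpos t) (hD i hi)
    rw [norm_smul, norm_mul, Real.norm_of_nonneg (Real.exp_pos _).le, mul_assoc]
    have hε : 0 ≤ ε := (abs_nonneg _).trans (huv i hi)
    exact mul_le_mul_of_nonneg_left
      (mul_le_mul (huv i hi) hx (norm_nonneg _) hε) (Real.exp_pos _).le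
  have h := norm_image_sub_le_of_norm_deriv_le_segment_01'
    (fun t _ => (hm t).hasDerivWithinAt) fun t _ => hbound t
  simpa [m, W] using h

end ExpWeightedMean

/-- The softplus function is 1-Lipschitz. -/
theorem abs_softplus_sub_le (a b : ℝ) :
    |Real.log (1 + Real.exp a) - Real.log (1 + Real.exp b)| ≤ |a - b| := by
  have key : ∀ a b : ℝ,
      Real.log (1 + Real.exp a) - Real.log (1 + Real.exp b) ≤ |a - b| := fun a b => by
    rw [sub_le_iff_le_add, Real.log_le_iff_le_exp (by positivity), Real.exp_add,
      Real.exp_log (by positivity), mul_add, mul_one, ← Real.exp_add]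
    exact add_le_add (Real.one_le_exp (abs_nonneg _))
      (Real.exp_le_exp.2 (by linarith [le_abs_self (a - b)]))
  exact abs_sub_le_iff.2 ⟨key a b, abs_sub_comm a b ▸ key b a⟩

/-- The smooth parameter selector with softplus-penalized weights is Lipschitz
in the predicted safety loss with constant κ·D (sup norm on predictions). -/
theorem smooth_selector_lipschitz
    (S : Finset (EuclideanSpace ℝ (Fin 2))) (hS : S.Nonempty)
    (D : ℝ) (hD : ∀ γ ∈ S, ∀ γ' ∈ S, ‖γ - γ'‖ ≤ D)
    (J : EuclideanSpace ℝ (Fin 2) → ℝ) (τ κ : ℝ) (hτ : 0 < τ) (hκ : 0 < κ)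
    (w : (EuclideanSpace ℝ (Fin 2) → ℝ) → EuclideanSpace ℝ (Fin 2) → ℝ)
    (hw : ∀ p γ, w p γ = Real.exp (J γ / τ - κ * Real.log (1 + Real.exp (p γ))))
    (sel : (EuclideanSpace ℝ (Fin 2) → ℝ) → EuclideanSpace ℝ (Fin 2))
    (hsel : ∀ p, sel p = (∑ γ ∈ S, w p γ)⁻¹ • ∑ γ ∈ S, w p γ • γ)
    (p p' : EuclideanSpace ℝ (Fin 2) → ℝ) :
    ‖sel p - sel p'‖ ≤ κ * D * S.sup' hS fun γ => |p γ - p' γ| := by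
  simp only [hsel, hw]
  rw [mul_right_comm]
  refine norm_exp_weighted_mean_sub_le hS (x := id) hD fun γ hγ => ?_
  rw [sub_sub_sub_cancel_left, ← mul_sub, abs_mul, abs_of_pos hκ, abs_sub_comm]
  exact mul_le_mul_of_nonneg_left ((abs_softplus_sub_le _ _).trans
    (Finset.le_sup' (fun γ => |p γ - p' γ|) hγ)) hκ.le
end

section
/- Let δmin > 0, 0 ≤ c ≤ δmin, Vψ > 0, and 0 < Δt ≤ (δmin − c)/Vψ. Let ψ : [0, ∞) → ℝ be differentiable with |ψ'(t)| ≤ Vψ for all t ≥ 0, and suppose ψ(k·Δt) ≥ δmin − c for every natural number k. Then ψ(t) ≥ 0 for all t ≥ 0. -/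
/-- Sampled-data forward invariance: if the margin is at least δmin − c at
every sample time k·Δt, |ψ'| ≤ Vψ on [0,∞), and Δt ≤ (δmin − c)/Vψ, then
ψ(t) ≥ 0 for all t ≥ 0. -/
theorem sampled_data_forward_invariance
    (δmin c Vψ Δt : ℝ) (hδ : 0 < δmin) (hc0 : 0 ≤ c) (hcδ : c ≤ δmin)
    (hV : 0 < Vψ) (hΔt0 : 0 < Δt) (hΔt : Δt ≤ (δmin - c) / Vψ)
    (ψ ψ' : ℝ → ℝ)
    (hderiv : ∀ t ∈ Set.Ici (0 : ℝ), HasDerivWithinAt ψ (ψ' t) (Set.Ici 0) t)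
    (hbound : ∀ t ∈ Set.Ici (0 : ℝ), |ψ' t| ≤ Vψ)
    (hsample : ∀ k : ℕ, δmin - c ≤ ψ (k * Δt)) :
    ∀ t ∈ Set.Ici (0 : ℝ), 0 ≤ ψ t := by
  intro t ht
  have ht0 : 0 ≤ t := ht
  have hle : (⌊t / Δt⌋₊ : ℝ) * Δt ≤ t :=
    (le_div_iff₀ hΔt0).mp (Nat.floor_le (div_nonneg ht0 hΔt0.le))
  have hlt : t < ((⌊t / Δt⌋₊ : ℝ) + 1) * Δt :=
    (div_lt_iff₀ hΔt0).mp (Nat.lt_floor_add_one (t / Δt))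
  have hk : (⌊t / Δt⌋₊ : ℝ) * Δt ∈ Set.Ici (0 : ℝ) :=
    mul_nonneg (Nat.cast_nonneg _) hΔt0.le
  have hlip := (convex_Ici (0 : ℝ)).norm_image_sub_le_of_norm_hasDerivWithin_le
    hderiv hbound hk ht
  rw [Real.norm_eq_abs, Real.norm_eq_abs, abs_of_nonneg (sub_nonneg.mpr hle)] at hlip
  have hgap : Vψ * (t - (⌊t / Δt⌋₊ : ℝ) * Δt) ≤ Vψ * Δt :=
    mul_le_mul_of_nonneg_left (by linarith) hV.le
  have hstep : Δt * Vψ ≤ δmin - c := (le_div_iff₀ hV).mp hΔt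
  linarith [neg_le_of_abs_le hlip, hsample ⌊t / Δt⌋₊]
end
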